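/- arXiv:2002.07167 — 2 statements merged into one kernel-verified Lean document; each statement's English description precedes it below -/
import Mathlib

section
/- Let A, B and C be finite-dimensional k-vector spaces, of dimensions a, b and c respectively, let r be an integer with 1 ≤ r ≤ min(b, c), and let φ : A → Hom_k(B, C) be a k-linear map. If the linear map φ(u) : B → C has rank ≥ r for every u ∈ A \ {0}, then a ≤ (b − r + 1)(c − r + 1). (Lemma 1.6; the special case r = b is Hartshorne's Bilinear Map Lemma.) -/
open MvPolynomial

namespace BML

lemma aeval_smul_of_hom {k σ : Type*} [Field k] {p : MvPolynomial σ k} {n : ℕ}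
    (hp : p.IsHomogeneous n) (t : k) (x : σ → k) :
    aeval (t • x) p = t ^ n * aeval x p := by
  change eval (t • x) p = t ^ n * eval x p
  simp only [MvPolynomial.eval_eq, Finset.mul_sum]
  refine Finset.sum_congr rfl fun d hd => ?_
  have h1 : d.degree = n := by
    have := hp (mem_support_iff.mp hd)
    rw [Finsupp.degree_eq_weight_one]; exact this
  have h2 : ∏ i ∈ d.support, t ^ d i = t ^ n := by
    rw [Finset.prod_pow_eq_pow_sum, ← h1, Finsupp.degree_apply]
  simp only [Pi.smul_apply, smul_eq_mul, mul_pow, Finset.prod_mul_distrib, h2]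
  ring

lemma hom_comp_mem {k σ : Type*} [Field k] [Infinite k] (W : Set (σ → k))
    (hW : ∀ x ∈ W, ∀ t : k, t • x ∈ W) {p : MvPolynomial σ k}
    (hp : p ∈ vanishingIdeal k W) (n : ℕ) :
    homogeneousComponent n p ∈ vanishingIdeal k W := by
  intro x hx
  let q : Polynomial k := ∑ i ∈ Finset.range (p.totalDegree + 1),
    Polynomial.monomial i (aeval x (homogeneousComponent i p))
  have hq : q = 0 := by
    apply Polynomial.funext
    intro t
    have h1 : aeval (t • x) p = 0 := hp _ (hW x hx t)
    rw [← sum_homogeneousComponent p, map_sum] at h1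
    simp only [q, Polynomial.eval_finsetSum, Polynomial.eval_monomial, Polynomial.eval_zero]
    rw [← h1]
    refine Finset.sum_congr rfl fun i _ => ?_
    rw [aeval_smul_of_hom (homogeneousComponent_isHomogeneous i p), mul_comm]
  by_cases hn : n < p.totalDegree + 1
  · have := congrArg (fun f => Polynomial.coeff f n) hq
    simpa [q, Polynomial.finsetSum_coeff, Polynomial.coeff_monomial, hn] using this
  · rw [homogeneousComponent_eq_zero _ _ (by omega), map_zero]

lemma hom_comp_mul {k σ : Type*} [Field k] (g l : MvPolynomial σ k) (hl : l.IsHomogeneous 1)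
    (n : ℕ) : homogeneousComponent (n + 1) (g * l) = homogeneousComponent n g * l := by
  conv_lhs => rw [← sum_homogeneousComponent g, Finset.sum_mul, map_sum]
  have h : ∀ i, homogeneousComponent (n + 1) (homogeneousComponent i g * l)
      = if n = i then homogeneousComponent i g * l else 0 := by
    intro i
    rw [homogeneousComponent_of_mem ((homogeneousComponent_isHomogeneous i g).mul hl)]
    simp
  simp only [h, Finset.sum_ite_eq, Finset.mem_range]
  split_ifs with hn
  · rfl
  · rw [homogeneousComponent_eq_zero _ _ (by omega), zero_mul]

lemma finite_of {k σ R τ : Type*} [Field k] [Fintype σ] [Fintype τ] [CommRing R] [Algebra k R]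
    (π : MvPolynomial σ k →ₐ[k] R) (hπ : Function.Surjective π) (l : τ → MvPolynomial σ k)
    (n : ℕ) (h : ∀ i, ∃ g : τ → MvPolynomial σ k, (∀ t, (g t).IsHomogeneous n) ∧
      π (X i ^ (n + 1)) = ∑ t, π (g t) * π (l t)) :
    Module.Finite (Algebra.adjoin k (Set.range fun t => π (l t))) R := by
  classical
  set T := Algebra.adjoin k (Set.range fun t => π (l t)) with hT
  let gen : (σ → Fin (n + 1)) → R := fun m => ∏ i, π (X i) ^ (m i : ℕ)
  let M : Submodule T R := Submodule.span T (Set.range gen)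
  have key : ∀ d, ∀ f : MvPolynomial σ k, f.IsHomogeneous d → π f ∈ M := by
    intro d
    induction d with
    | zero =>
      intro f hf
      rw [← homogeneousComponent_eq_self hf, homogeneousComponent_zero]
      have h0 : gen (fun _ => 0) ∈ M := Submodule.subset_span ⟨_, rfl⟩
      have := M.smul_mem (algebraMap k T (coeff 0 f)) h0
      convert this using 1
      rw [Algebra.smul_def, ← IsScalarTower.algebraMap_apply]
      simp [gen, ← MvPolynomial.algebraMap_eq]
    | succ d ih =>
      intro f hf
      rw [← support_sum_monomial_coeff f, map_sum]
      refine Submodule.sum_mem _ fun m hm => ?_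
      have hmd : m.degree = d + 1 := by
        have := hf (mem_support_iff.mp hm)
        rw [Finsupp.degree_eq_weight_one]; exact this
      generalize coeff m f = c
      by_cases hsm : ∀ i, m i < n + 1
      · have h0 : gen (fun i => ⟨m i, hsm i⟩) ∈ M := Submodule.subset_span ⟨_, rfl⟩
        have := M.smul_mem (algebraMap k T c) h0
        convert this using 1
        rw [Algebra.smul_def, ← IsScalarTower.algebraMap_apply, monomial_eq, map_mul,
          ← MvPolynomial.algebraMap_eq, AlgHom.commutes, Finsupp.prod_fintype _ _ (by simp)]
        simp [gen]
      · push Not at hsm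
        obtain ⟨i, hi⟩ := hsm
        obtain ⟨g, hg, hgs⟩ := h i
        have hm' : m = (m - Finsupp.single i (n + 1)) + Finsupp.single i (n + 1) := by
          rw [tsub_add_cancel_of_le]
          exact Finsupp.single_le_iff.mpr hi
        set m' := m - Finsupp.single i (n + 1) with hm'd
        have hdeg : m'.degree + (n + 1) = d + 1 := by
          rw [← hmd, hm', map_add, Finsupp.degree_single]
        have hmon : monomial m c = monomial m' c * X i ^ (n + 1) := by
          rw [X_pow_eq_monomial, monomial_mul, ← hm', mul_one]
        rw [hmon, map_mul, hgs, Finset.mul_sum]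
        refine Submodule.sum_mem _ fun t _ => ?_
        have h1 : π (monomial m' c * g t) ∈ M := by
          apply ih
          have := (isHomogeneous_monomial (d := m') c rfl).mul (hg t)
          convert this using 1
          omega
        have := M.smul_mem (⟨π (l t), Algebra.subset_adjoin ⟨t, rfl⟩⟩ : T) h1
        convert this using 1
        rw [Algebra.smul_def, map_mul]
        change _ = π (l t) * _
        ring
  refine ⟨⟨(Set.finite_range gen).toFinset, ?_⟩⟩
  rw [Set.Finite.coe_toFinset, eq_top_iff]
  rintro y -
  obtain ⟨f, rfl⟩ := hπ y
  rw [← sum_homogeneousComponent f, map_sum]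
  exact Submodule.sum_mem _ fun i _ => key i _ (homogeneousComponent_isHomogeneous i f)

lemma cone {k σ Λ : Type*} [Field k] [IsAlgClosed k] [Fintype σ] [Fintype Λ]
    (W : Set (σ → k)) (hW : ∀ x ∈ W, ∀ t : k, t • x ∈ W)
    (hP : (vanishingIdeal k W).IsPrime)
    (v : Λ → MvPolynomial σ k ⧸ vanishingIdeal k W) (hv : AlgebraicIndependent k v)
    (N : ℕ) (l : Fin N → MvPolynomial σ k) (hl : ∀ t, (l t).IsHomogeneous 1)
    (hz : ∀ x ∈ zeroLocus k (vanishingIdeal k W), (∀ t, aeval x (l t) = 0) → x = 0) :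
    Fintype.card Λ ≤ N := by
  classical
  have : Infinite k := IsAlgClosed.instInfinite
  set P := vanishingIdeal k W with hPd
  let I := P ⊔ Ideal.span (Set.range l)
  have hX : ∀ i, ∃ n : ℕ, (X i : MvPolynomial σ k) ^ n ∈ I := by
    intro i
    have : (X i : MvPolynomial σ k) ∈ vanishingIdeal k (zeroLocus k I) := by
      intro x hx
      have : x = 0 := by
        apply hz x
        · exact zeroLocus_anti_mono le_sup_left hx
        · intro t
          exact hx _ (Ideal.mem_sup_right (Ideal.subset_span ⟨t, rfl⟩))
      simp [this]
    rw [vanishingIdeal_zeroLocus_eq_radical] at this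
    exact this
  choose nn hnn using hX
  let n := ∑ i, nn i
  let π := Ideal.Quotient.mkₐ k P
  have hfin : Module.Finite (Algebra.adjoin k (Set.range fun t => π (l t)))
      (MvPolynomial σ k ⧸ P) := by
    apply finite_of π (Ideal.Quotient.mkₐ_surjective k P) l n
    intro i
    have hle : nn i ≤ n + 1 := (Finset.single_le_sum (f := nn) (fun _ _ => Nat.zero_le _)
      (Finset.mem_univ i)).trans (Nat.le_succ _)
    have hmem : (X i : MvPolynomial σ k) ^ (n + 1) ∈ I := Ideal.pow_mem_of_pow_mem _ (hnn i) hle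
    obtain ⟨p, hp, q, hq, hpq⟩ := Submodule.mem_sup.mp hmem
    obtain ⟨g, rfl⟩ := (Ideal.mem_span_range_iff_exists_fun).mp hq
    refine ⟨fun t => homogeneousComponent n (g t), fun t => homogeneousComponent_isHomogeneous _ _, ?_⟩
    have h1 := congrArg (homogeneousComponent (n + 1)) hpq
    rw [homogeneousComponent_eq_self (isHomogeneous_X_pow i (n+1)), map_add, map_sum] at h1
    simp only [hom_comp_mul _ _ (hl _)] at h1
    rw [← h1, map_add, map_sum]
    have h2 : π (homogeneousComponent (n + 1) p) = 0 :=
      Ideal.Quotient.eq_zero_iff_mem.mpr (hom_comp_mem W hW hp _)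
    rw [h2, zero_add]
    simp
  have hdom : IsDomain (MvPolynomial σ k ⧸ P) := Ideal.Quotient.isDomain P
  have halg : Algebra.IsAlgebraic (Algebra.adjoin k (Set.range fun t => π (l t)))
    (MvPolynomial σ k ⧸ P) := inferInstance
  have h1 := Algebra.IsAlgebraic.trdeg_le_cardinalMk k (Set.range fun t => π (l t))
  have h2 := hv.lift_cardinalMk_le_trdeg
  have h3 : Cardinal.mk (Set.range fun t => π (l t)) ≤ (N : Cardinal) := by
    have := Cardinal.mk_range_le_lift (f := fun t => π (l t))
    simpa using this
  have h4 := h2.trans (Cardinal.lift_le.mpr (h1.trans h3))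
  simpa using h4

/-- matrices which factor through `k^s` -/
def W (k : Type*) [Field k] (s : ℕ) (m n : Type*) : Set (m × n → k) :=
  {x | ∃ (Y : Matrix m (Fin s) k) (Z : Matrix (Fin s) n k), ∀ i j, x (i, j) = (Y * Z) i j}

lemma W_prime (k : Type*) [Field k] [Infinite k] (s : ℕ) (m n : Type*) :
    (vanishingIdeal k (W k s m n)).IsPrime := by
  let ψ : MvPolynomial (m × n) k →ₐ[k] MvPolynomial ((m × Fin s) ⊕ (Fin s × n)) k :=
    aeval fun ij => ∑ a, X (Sum.inl (ij.1, a)) * X (Sum.inr (a, ij.2))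
  have : vanishingIdeal k (W k s m n) = RingHom.ker ψ := by
    ext p
    rw [RingHom.mem_ker]
    have hev : ∀ z : (m × Fin s) ⊕ (Fin s × n) → k, eval z (ψ p) =
        aeval (fun ij : m × n => ∑ a, z (Sum.inl (ij.1, a)) * z (Sum.inr (a, ij.2))) p := by
      intro z
      rw [← MvPolynomial.coe_aeval_eq_eval, RingHom.coe_coe]
      simp only [ψ]
      rw [← AlgHom.comp_apply, MvPolynomial.comp_aeval]
      simp
    constructor
    · intro hp
      apply MvPolynomial.funext
      intro z
      rw [hev, map_zero]
      exact hp _ ⟨fun i a => z (Sum.inl (i, a)), fun a j => z (Sum.inr (a, j)), fun i j => rfl⟩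
    · rintro hp x ⟨Y, Z, hx⟩
      have := hev (Sum.elim (fun ia => Y ia.1 ia.2) (fun aj => Z aj.1 aj.2))
      rw [hp, map_zero] at this
      rw [this]
      congr 2
      ext ⟨i, j⟩
      rw [hx]
      simp [Matrix.mul_apply]
  rw [this]
  exact RingHom.ker_isPrime _

lemma W_smul (k : Type*) [Field k] (s : ℕ) (m n : Type*) :
    ∀ x ∈ W k s m n, ∀ t : k, t • x ∈ W k s m n := by
  rintro x ⟨Y, Z, h⟩ t
  exact ⟨t • Y, Z, fun i j => by simp [h]⟩

/-- embedding of the index set of free entries -/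
def emb (s b c : ℕ) : (Fin s × (Fin s ⊕ Fin c)) ⊕ (Fin b × Fin s) →
    (Fin s ⊕ Fin b) × (Fin s ⊕ Fin c) :=
  Sum.elim (fun p => (Sum.inl p.1, p.2)) (fun p => (Sum.inr p.1, Sum.inl p.2))

lemma W_indep (k : Type*) [Field k] [Infinite k] (s b c : ℕ) :
    AlgebraicIndependent k (fun t => Ideal.Quotient.mkₐ k
      (vanishingIdeal k (W k s (Fin s ⊕ Fin b) (Fin s ⊕ Fin c))) (X (emb s b c t))) := by
  rw [algebraicIndependent_iff]
  intro F hF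
  have hF' : rename (emb s b c) F ∈ vanishingIdeal k (W k s (Fin s ⊕ Fin b) (Fin s ⊕ Fin c)) := by
    rw [← Ideal.Quotient.eq_zero_iff_mem, ← hF, ← Ideal.Quotient.mkₐ_eq_mk k]
    rw [show rename (emb s b c) F = aeval (fun t => (X (emb s b c t) : MvPolynomial _ k)) F by
      rw [← aeval_X_left_apply (rename (emb s b c) F), aeval_rename]; rfl, ← AlgHom.comp_apply, MvPolynomial.comp_aeval]
  let D : MvPolynomial ((Fin s × (Fin s ⊕ Fin c)) ⊕ (Fin b × Fin s)) k :=
    Matrix.det (Matrix.of fun i j : Fin s => X (Sum.inl (i, Sum.inl j)))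
  have hDe : ∀ z, eval z D = Matrix.det (Matrix.of fun i j : Fin s => z (Sum.inl (i, Sum.inl j))) := by
    intro z
    simp only [D]
    rw [RingHom.map_det]
    congr 1
    ext i j
    simp
  have hD : D ≠ 0 := by
    intro h0
    have := hDe (Sum.elim (fun p => Sum.elim (fun j => (1 : Matrix (Fin s) (Fin s) k) p.1 j) 0 p.2) 0)
    rw [h0, map_zero] at this
    simp only [Sum.elim_inl] at this
    have h1 : (Matrix.of fun i j => (1 : Matrix (Fin s) (Fin s) k) i j) = 1 := rfl
    rw [h1, Matrix.det_one] at this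
    exact zero_ne_one this
  have hFD : F * D = 0 := by
    apply MvPolynomial.funext
    intro z
    rw [map_mul, map_zero, mul_eq_zero]
    by_cases hz : eval z D = 0
    · exact Or.inr hz
    · left
      rw [hDe] at hz
      set M0 : Matrix (Fin s) (Fin s) k := Matrix.of fun i j : Fin s => z (Sum.inl (i, Sum.inl j))
        with hM0
      let N0 : Matrix (Fin s) (Fin s ⊕ Fin c) k := Matrix.of fun i j => z (Sum.inl (i, j))
      let Q : Matrix (Fin b) (Fin s) k := Matrix.of fun i j => z (Sum.inr (i, j))
      let Y : Matrix (Fin s ⊕ Fin b) (Fin s) k := Matrix.of (Sum.elim M0 Q)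
      let Z : Matrix (Fin s) (Fin s ⊕ Fin c) k := M0⁻¹ * N0
      have hu : IsUnit M0.det := isUnit_iff_ne_zero.mpr hz
      have hx := hF' (fun ij => (Y * Z) ij.1 ij.2) ⟨Y, Z, fun i j => rfl⟩
      rw [aeval_rename] at hx
      rw [← hx, ← MvPolynomial.coe_aeval_eq_eval, RingHom.coe_coe]
      congr 2
      ext t
      rcases t with ⟨i, j⟩ | ⟨i, j⟩
      · have : M0 * Z = N0 := by
          simp only [Z]; rw [Matrix.mul_nonsing_inv_cancel_left _ _ hu]
        change N0 i j = (Y * Z) (Sum.inl i) j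
        rw [← this]
        rfl
      · have h1 : ∀ a (j : Fin s), Z a (Sum.inl j) = (1 : Matrix (Fin s) (Fin s) k) a j := by
          intro a j
          rw [← Matrix.nonsing_inv_mul M0 hu]
          rfl
        change Q i j = (Y * Z) (Sum.inr i) (Sum.inl j)
        rw [Matrix.mul_apply]
        simp only [h1]
        rw [← Matrix.mul_one Q, Matrix.mul_apply]
        rfl
  exact (mul_eq_zero.mp hFD).resolve_right hD

lemma W_rank (k : Type*) [Field k] (s : ℕ) {m n : Type*} [Fintype m] [Fintype n]
    [DecidableEq n] [DecidableEq m]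
    (x : m × n → k) (hx : x ∈ zeroLocus k (vanishingIdeal k (W k s m n)))
    (U : Matrix (Fin (s + 1)) m k) (V : Matrix n (Fin (s + 1)) k)
    (h : U * (Matrix.of fun i j => x (i, j)) * V = 1) : False := by
  let p : MvPolynomial (m × n) k :=
    Matrix.det (U.map (C : k → MvPolynomial (m × n) k) *
      (Matrix.of fun i j => X (i, j) : Matrix m n (MvPolynomial (m × n) k)) *
      V.map (C : k → MvPolynomial (m × n) k))
  have hp : ∀ y : m × n → k, aeval y p = Matrix.det (U * (Matrix.of fun i j => y (i, j)) * V) := by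
    intro y
    simp only [p]
    rw [AlgHom.map_det]
    congr 1
    ext i j
    simp [Matrix.mul_apply]
  have hpm : p ∈ vanishingIdeal k (W k s m n) := by
    rintro y ⟨Y, Z, hy⟩
    rw [hp]
    have : (Matrix.of fun i j => y (i, j)) = Y * Z := by ext i j; simp [hy]
    rw [this]
    by_contra hne
    have h1 := Matrix.rank_of_isUnit _ ((Matrix.isUnit_iff_isUnit_det _).mpr
      (isUnit_iff_ne_zero.mpr hne))
    have h2 : U * (Y * Z) * V = (U * Y) * (Z * V) := by simp only [Matrix.mul_assoc]
    rw [h2] at h1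
    have h3 := Matrix.rank_mul_le_left (U * Y) (Z * V)
    have h4 := Matrix.rank_le_width (U * Y)
    simp at h1
    omega
  have := hx p hpm
  rw [hp, h, Matrix.det_one] at this
  exact one_ne_zero this

lemma exists_id {k E F : Type*} [Field k] [AddCommGroup E] [Module k E] [AddCommGroup F]
    [Module k F] [FiniteDimensional k F] (f : E →ₗ[k] F) (r : ℕ)
    (h : r ≤ Module.finrank k (LinearMap.range f)) :
    ∃ (g : F →ₗ[k] (Fin r → k)) (e : (Fin r → k) →ₗ[k] E), g ∘ₗ f ∘ₗ e = LinearMap.id := by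
  obtain ⟨w, hw⟩ := exists_linearIndependent_of_le_finrank h
  let i : (Fin r → k) →ₗ[k] LinearMap.range f := Fintype.linearCombination k w
  have hi : Function.Injective i := by
    exact linearIndependent_iff_injective_fintypeLinearCombination.mp hw
  obtain ⟨e, he⟩ := Module.projective_lifting_property f.rangeRestrict i
    f.surjective_rangeRestrict
  have hinj : Function.Injective (f ∘ₗ e) := by
    have : f ∘ₗ e = (LinearMap.range f).subtype ∘ₗ i := by rw [← he]; rfl
    rw [this]
    exact (Submodule.subtype_injective _).comp hi
  obtain ⟨g, hg⟩ := LinearMap.exists_leftInverse_of_injective (f ∘ₗ e)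
    (LinearMap.ker_eq_bot.mpr hinj)
  exact ⟨g, e, hg⟩

end BML

theorem stmt0 (k : Type*) [Field k] [IsAlgClosed k] [CharZero k]
    (A B C : Type*) [AddCommGroup A] [Module k A] [FiniteDimensional k A]
    [AddCommGroup B] [Module k B] [FiniteDimensional k B]
    [AddCommGroup C] [Module k C] [FiniteDimensional k C]
    (r : ℕ) (hr1 : 1 ≤ r) (hr : r ≤ min (Module.finrank k B) (Module.finrank k C))
    (φ : A →ₗ[k] (B →ₗ[k] C))
    (hrank : ∀ u : A, u ≠ 0 → r ≤ Module.finrank k (LinearMap.range (φ u))) :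
    Module.finrank k A ≤
      (Module.finrank k B - r + 1) * (Module.finrank k C - r + 1) := by
  classical
  have hinf : Infinite k := IsAlgClosed.instInfinite
  obtain ⟨s, rfl⟩ : ∃ s, r = s + 1 := ⟨r - 1, by omega⟩
  obtain ⟨hB, hC⟩ := le_min_iff.mp hr
  obtain ⟨b, hb⟩ : ∃ b, Module.finrank k B = s + b := ⟨Module.finrank k B - s, by omega⟩
  obtain ⟨c, hc⟩ : ∃ c, Module.finrank k C = s + c := ⟨Module.finrank k C - s, by omega⟩
  let bB : Module.Basis (Fin s ⊕ Fin b) k B :=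
    (Module.finBasisOfFinrankEq k B hb).reindex finSumFinEquiv.symm
  let bC : Module.Basis (Fin s ⊕ Fin c) k C :=
    (Module.finBasisOfFinrankEq k C hc).reindex finSumFinEquiv.symm
  let Ψ : A →ₗ[k] ((Fin s ⊕ Fin c) × (Fin s ⊕ Fin b) → k) :=
    { toFun := fun u ij => LinearMap.toMatrix bB bC (φ u) ij.1 ij.2
      map_add' := fun u v => by ext; simp
      map_smul' := fun t u => by ext; simp }
  have hΨ : Function.Injective Ψ := by
    rw [injective_iff_map_eq_zero]
    intro u hu
    by_contra hne
    have h1 : LinearMap.toMatrix bB bC (φ u) = 0 := by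
      ext i j; exact congrFun hu (i, j)
    have h2 : φ u = 0 := by simpa using h1
    have := hrank u hne
    rw [h2, LinearMap.range_zero, finrank_bot] at this
    omega
  let Q := ((Fin s ⊕ Fin c) × (Fin s ⊕ Fin b) → k) ⧸ LinearMap.range Ψ
  let N := Module.finrank k Q
  have hN : N + Module.finrank k A = (s + c) * (s + b) := by
    have := Submodule.finrank_quotient_add_finrank (LinearMap.range Ψ)
    rw [LinearMap.finrank_range_of_inj hΨ] at this
    simpa using this
  let bQ := Module.finBasis k Q
  let L : Fin N → (((Fin s ⊕ Fin c) × (Fin s ⊕ Fin b) → k) →ₗ[k] k) := fun t =>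
    bQ.coord t ∘ₗ (LinearMap.range Ψ).mkQ
  let l : Fin N → MvPolynomial ((Fin s ⊕ Fin c) × (Fin s ⊕ Fin b)) k := fun t =>
    ∑ ij, MvPolynomial.C (L t (Pi.single ij 1)) * X ij
  have hl : ∀ t, (l t).IsHomogeneous 1 := by
    intro t
    refine MvPolynomial.IsHomogeneous.sum _ _ _ fun ij _ => ?_
    simpa using (isHomogeneous_C _ (L t (Pi.single ij 1))).mul (isHomogeneous_X k ij)
  have hle : ∀ t x, aeval x (l t) = L t x := by
    intro t x
    conv_rhs => rw [LinearMap.pi_apply_eq_sum_univ (L t) x]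
    simp only [l, map_sum, map_mul, aeval_X, smul_eq_mul, aeval_C, Algebra.algebraMap_self_apply]
    refine Finset.sum_congr rfl fun ij _ => ?_
    rw [mul_comm]
    congr 2
    ext a
    simp [Pi.single_apply, eq_comm]
  have key := BML.cone (BML.W k s (Fin s ⊕ Fin c) (Fin s ⊕ Fin b)) (BML.W_smul k s _ _)
    (BML.W_prime k s _ _) _ (BML.W_indep k s c b) N l hl (by
      intro x hx hxl
      have hq : (LinearMap.range Ψ).mkQ x = 0 := by
        apply bQ.ext_elem
        intro t
        have := hxl t
        rw [hle] at this
        rw [map_zero]; exact this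
      rw [Submodule.mkQ_apply, Submodule.Quotient.mk_eq_zero] at hq
      obtain ⟨u, rfl⟩ := hq
      by_contra hne
      have hu : u ≠ 0 := by rintro rfl; exact hne (map_zero _)
      obtain ⟨g, e, hge⟩ := BML.exists_id (φ u) (s + 1) (hrank u hu)
      let st := Pi.basisFun k (Fin (s + 1))
      refine BML.W_rank k s _ hx (LinearMap.toMatrix bC st g) (LinearMap.toMatrix st bB e) ?_
      have h1 : (Matrix.of fun i j => Ψ u (i, j)) = LinearMap.toMatrix bB bC (φ u) := rfl
      rw [h1, ← LinearMap.toMatrix_comp, ← LinearMap.toMatrix_comp, LinearMap.comp_assoc, hge,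
        LinearMap.toMatrix_id])
  simp only [Fintype.card_sum, Fintype.card_prod, Fintype.card_fin] at key
  have e1 : Module.finrank k B - (s + 1) + 1 = b := by omega
  have e2 : Module.finrank k C - (s + 1) + 1 = c := by omega
  rw [e1, e2]
  nlinarith
end

section
/- Let V be a 5-dimensional k-vector space and let ω, ω′ ∈ Λ²V. Then there exist linearly independent vectors v, w ∈ V such that v ∧ w ∧ ω = 0 and v ∧ w ∧ ω′ = 0 in Λ⁴V. (This is the linear-algebra content of Subclaim 4.1 in the proof of Proposition 2.2: there is no locally split monomorphism Ω³_{P⁴}(3) → 2Ω¹_{P⁴}(1).) -/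
open ExteriorAlgebra

lemma aux_ker {k W : Type*} [Field k] [CharZero k] [AddCommGroup W] [Module k W]
    [FiniteDimensional k W] (hW : Odd (Module.finrank k W)) (A : W →ₗ[k] W →ₗ[k] k)
    (hA : ∀ x y, A x y = - A y x) : ∃ u : W, u ≠ 0 ∧ ∀ y, A u y = 0 := by
  classical
  let b := Module.finBasis k W
  let M : Matrix _ _ k := LinearMap.toMatrix₂ b b A
  have hM : M.transpose = -M := by
    ext i j
    simp only [M, Matrix.transpose_apply, Matrix.neg_apply, LinearMap.toMatrix₂_apply]
    exact hA _ _
  have hdet : M.det = 0 := by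
    have h := congrArg Matrix.det hM
    rw [Matrix.det_transpose, Matrix.det_neg, Fintype.card_fin, hW.neg_one_pow] at h
    have : (2 : k) * M.det = 0 := by linear_combination h
    simpa using this
  obtain ⟨v, hv, hMv⟩ := Matrix.exists_vecMul_eq_zero_iff.mpr hdet
  refine ⟨∑ i, v i • b i, ?_, ?_⟩
  · intro h
    apply hv
    ext i
    exact Fintype.linearIndependent_iff.mp b.linearIndependent v h i
  · intro y
    have : A (∑ i, v i • b i) = 0 := by
      apply b.ext
      intro j
      have := congrFun hMv j
      simpa [Matrix.vecMul, dotProduct, M, LinearMap.toMatrix₂_apply] using this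
    rw [this]; rfl

lemma aux3 {k W : Type*} [Field k] [CharZero k] [AddCommGroup W] [Module k W]
    [FiniteDimensional k W] (hW : Module.finrank k W = 3) (A B : W →ₗ[k] W →ₗ[k] k)
    (hA : ∀ x y, A x y = - A y x) (hB : ∀ x y, B x y = - B y x) :
    ∃ a b : W, LinearIndependent k ![a, b] ∧ A a b = 0 ∧ B a b = 0 := by
  obtain ⟨a, ha, hAa⟩ := aux_ker (by rw [hW]; decide) A hA
  obtain ⟨b, hb, hBb⟩ := aux_ker (by rw [hW]; decide) B hB
  by_cases h : LinearIndependent k ![a, b]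
  · exact ⟨a, b, h, hAa b, by rw [hB, hBb, neg_zero]⟩
  · rw [LinearIndependent.pair_iff' ha] at h
    push Not at h
    obtain ⟨t, rfl⟩ := h
    have ht : t ≠ 0 := by rintro rfl; simp at hb
    have : ∃ c, c ∉ Submodule.span k {a} := by
      by_contra! hc
      have h1 : Submodule.span k {a} = ⊤ := by ext; simp [hc]
      have h2 := finrank_span_singleton (K := k) ha
      rw [h1, finrank_top] at h2
      omega
    obtain ⟨c, hc⟩ := this
    refine ⟨a, c, ?_, hAa c, ?_⟩
    · rw [LinearIndependent.pair_iff' ha]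
      intro s hs
      exact hc (Submodule.mem_span_singleton.mpr ⟨s, hs⟩)
    · have := hBb c
      simpa [ht] using this

lemma aux5 {k W : Type*} [Field k] [CharZero k] [AddCommGroup W] [Module k W]
    [FiniteDimensional k W] (hW : Module.finrank k W = 5) (A B : W →ₗ[k] W →ₗ[k] k)
    (hA : ∀ x y, A x y = - A y x) (hB : ∀ x y, B x y = - B y x) :
    ∃ f : Fin 3 → W, LinearIndependent k f ∧ ∀ i j, A (f i) (f j) = 0 ∧ B (f i) (f j) = 0 := by
  obtain ⟨u, hu, hAu⟩ := aux_ker (by rw [hW]; decide) A hA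
  obtain ⟨C, hC⟩ := Submodule.exists_isCompl (Submodule.span k {u})
  have h1 := Submodule.finrank_add_eq_of_isCompl hC
  rw [finrank_span_singleton hu, hW] at h1
  have h2 := LinearMap.finrank_range_add_finrank_ker (B u)
  have h3 : Module.finrank k (LinearMap.range (B u)) ≤ 1 := by
    simpa using Submodule.finrank_le (LinearMap.range (B u))
  have h4 := Submodule.finrank_sup_add_finrank_inf_eq C (LinearMap.ker (B u))
  have h5 := Submodule.finrank_le (C ⊔ LinearMap.ker (B u))
  have h6 : 3 ≤ Module.finrank k (C ⊓ LinearMap.ker (B u) : Submodule k W) := by omega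
  obtain ⟨m, hm⟩ := exists_linearIndependent_of_le_finrank h6
  have hm' := hm.map' _ (Submodule.ker_subtype _)
  let M := Submodule.span k (Set.range ((C ⊓ LinearMap.ker (B u)).subtype ∘ m))
  have hMle : M ≤ C ⊓ LinearMap.ker (B u) := by
    rw [Submodule.span_le]
    rintro _ ⟨i, rfl⟩
    exact (m i).2
  have hM : Module.finrank k M = 3 := by
    exact (finrank_span_eq_card hm').trans (by simp)
  obtain ⟨a, b, hab, hAab, hBab⟩ := aux3 hM (A.domRestrict₁₂ M M) (B.domRestrict₁₂ M M)
    (fun x y => hA x y) (fun x y => hB x y)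
  have hAab : A a b = 0 := hAab
  have hBab : B a b = 0 := hBab
  have hBa : B u a = 0 := (hMle a.2).2
  have hBb : B u b = 0 := (hMle b.2).2
  have sA : ∀ x, A x x = 0 := fun x => self_eq_neg.mp (hA x x)
  have sB : ∀ x, B x x = 0 := fun x => self_eq_neg.mp (hB x x)
  have e1 : A b a = 0 := by rw [hA, hAab, neg_zero]
  have e2 : B b a = 0 := by rw [hB, hBab, neg_zero]
  have e3 : B a u = 0 := by rw [hB, hBa, neg_zero]
  have e4 : B b u = 0 := by rw [hB, hBb, neg_zero]
  have e5 : ∀ x, A x u = 0 := fun x => by rw [hA, hAu, neg_zero]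
  refine ⟨![u, a, b], ?_, ?_⟩
  · have hab' : LinearIndependent k ![(a : W), (b : W)] := by
      have := hab.map' M.subtype (Submodule.ker_subtype _)
      have hh : (M.subtype ∘ ![a, b]) = ![(a : W), (b : W)] := by
        ext i; fin_cases i <;> rfl
      rwa [hh] at this
    refine linearIndependent_finCons.mpr ⟨hab', ?_⟩
    intro hmem
    have : Submodule.span k (Set.range ![(a : W), (b : W)]) ≤ C := by
      rw [Submodule.span_le]
      rintro _ ⟨i, rfl⟩
      fin_cases i
      · exact (hMle a.2).1
      · exact (hMle b.2).1
    exact hu (Submodule.disjoint_def.mp hC.disjoint u (Submodule.mem_span_singleton_self u)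
      (this hmem))
  · intro i j
    fin_cases i <;> fin_cases j <;>
      simp [hAu, hAab, hBab, hBa, hBb, sA, sB, e1, e2, e3, e4, e5]

lemma aux_form {k V : Type*} [Field k] [AddCommGroup V] [Module k V]
    (ω : ExteriorAlgebra k V) (hω : ω ∈ ⋀[k]^2 V) :
    ∃ C : Module.Dual k V →ₗ[k] Module.Dual k V →ₗ[k] k, ∀ e : Module.Basis (Fin 5) k V,
      ω = ∑ p, ∑ q, C (e.coord p) (e.coord q) • (ι k (e p) * ι k (e q)) := by
  rw [exteriorPower, pow_two] at hω
  induction hω using Submodule.mul_induction_on' with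
  | mem_mul_mem m hm n hn =>
    obtain ⟨x, rfl⟩ := hm
    obtain ⟨y, rfl⟩ := hn
    refine ⟨LinearMap.mk₂ k (fun f g => f x * g y) ?_ ?_ ?_ ?_, ?_⟩
    · intros; simp [add_mul]
    · intros; simp [mul_assoc]
    · intros; simp [mul_add]
    · intros; simp [mul_left_comm]
    · intro e
      conv_lhs => rw [← e.sum_repr x, ← e.sum_repr y]
      simp only [map_sum, map_smul, Finset.sum_mul, Finset.mul_sum, smul_mul_smul_comm,
        LinearMap.mk₂_apply, Module.Basis.coord_apply]
      try rw [Finset.sum_comm]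
  | add x hx y hy h1 h2 =>
    obtain ⟨C, hC⟩ := h1
    obtain ⟨D, hD⟩ := h2
    refine ⟨C + D, fun e => ?_⟩
    conv_lhs => rw [hC e, hD e]
    simp only [LinearMap.add_apply, add_smul, Finset.sum_add_distrib]

lemma aux_van {k V : Type*} [Field k] [CharZero k] [AddCommGroup V] [Module k V]
    (ω : ExteriorAlgebra k V) (c : Fin 5 → Fin 5 → k) (e : Fin 5 → V)
    (h : ω = ∑ p, ∑ q, c p q • (ι k (e p) * ι k (e q)))
    (hc : ∀ p q : Fin 3, c (p.castLE (by omega)) (q.castLE (by omega)) =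
      c (q.castLE (by omega)) (p.castLE (by omega))) :
    ι k (e 3) * ι k (e 4) * ω = 0 := by
  have sq : ∀ x : V, ι k x * ι k x = 0 := fun x => ι_sq_zero x
  have anti : ∀ x y : V, ι k x * ι k y = - (ι k y * ι k x) := fun x y =>
    eq_neg_of_add_eq_zero_left (ι_add_mul_swap x y)
  have a3 : ∀ x, ι k (e 3) * ι k (e 4) * (ι k (e 3) * ι k x) = 0 := fun x => by
    rw [anti (e 3) (e 4), neg_mul, mul_assoc, ← mul_assoc (ι k (e 3)), sq]; simp
  have a4 : ∀ x, ι k (e 3) * ι k (e 4) * (ι k (e 4) * ι k x) = 0 := fun x => by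
    rw [mul_assoc, ← mul_assoc (ι k (e 4)), sq]; simp
  have b3 : ∀ x, ι k (e 3) * ι k (e 4) * (ι k x * ι k (e 3)) = 0 := fun x => by
    rw [anti x, mul_neg, a3, neg_zero]
  have b4 : ∀ x, ι k (e 3) * ι k (e 4) * (ι k x * ι k (e 4)) = 0 := fun x => by
    rw [anti x, mul_neg, a4, neg_zero]
  have c01 : c 0 1 = c 1 0 := hc 0 1
  have c02 : c 0 2 = c 2 0 := hc 0 2
  have c12 : c 1 2 = c 2 1 := hc 1 2
  rw [h]
  simp only [Fin.sum_univ_five, mul_add, mul_smul_comm, a3, a4, b3, b4, sq, c01, c02, c12,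
    anti (e 1) (e 0), anti (e 2) (e 0), anti (e 2) (e 1)]
  simp only [mul_neg, mul_zero, smul_zero, smul_neg]
  abel

/-- Linear-algebra content of Subclaim 4.1 in the proof of Proposition 2.2. Let `V` be a
`5`-dimensional vector space over an algebraically closed field `k` of characteristic zero
and let `ω, ω′ ∈ Λ²V`. Then there exist linearly independent vectors `v, w ∈ V` such that
`v ∧ w ∧ ω = 0` and `v ∧ w ∧ ω′ = 0` in `Λ⁴V`. -/
theorem stmt5 (k : Type*) [Field k] [IsAlgClosed k] [CharZero k]
    (V : Type*) [AddCommGroup V] [Module k V] [FiniteDimensional k V]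
    (hV : Module.finrank k V = 5)
    (ω ω' : ExteriorAlgebra k V) (hω : ω ∈ ⋀[k]^2 V) (hω' : ω' ∈ ⋀[k]^2 V) :
    ∃ v w : V, LinearIndependent k ![v, w] ∧
      ι k v * ι k w * ω = 0 ∧ ι k v * ι k w * ω' = 0 := by
  obtain ⟨C, hC⟩ := aux_form ω hω
  obtain ⟨D, hD⟩ := aux_form ω' hω'
  have hW : Module.finrank k (Module.Dual k V) = 5 := by
    rw [Subspace.dual_finrank_eq, hV]
  obtain ⟨f, hf, hAB⟩ := aux5 hW (C - C.flip) (D - D.flip) (by intros; simp) (by intros; simp)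
  obtain ⟨x, hx⟩ := exists_linearIndependent_snoc_of_lt_finrank hf (by omega)
  obtain ⟨y, hy⟩ := exists_linearIndependent_snoc_of_lt_finrank hx (by omega)
  let b := basisOfLinearIndependentOfCardEqFinrank hy (by simp [hW])
  let e : Module.Basis (Fin 5) k V := b.dualBasis.map (Module.evalEquiv k V).symm
  have he : ∀ p, e.coord p = b p := by
    intro p
    apply e.ext
    intro q
    have h1 : (b p) (e q) = Module.evalEquiv k V (e q) (b p) := rfl
    have h2 : Module.evalEquiv k V (e q) = b.dualBasis q := by
      simp only [e, Module.Basis.map_apply, LinearEquiv.apply_symm_apply]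
    rw [h1, h2, Module.Basis.coord_apply, Module.Basis.repr_self, Finsupp.single_apply]
    rw [Module.Basis.dualBasis_apply_self]
    simp only [eq_comm]
  have hb : ∀ p : Fin 3, b (p.castLE (by omega)) = f p := by
    intro p
    simp only [b, coe_basisOfLinearIndependentOfCardEqFinrank]
    fin_cases p <;> rfl
  refine ⟨e 3, e 4, ?_, ?_, ?_⟩
  · have := e.linearIndependent.comp ![3, 4] (by decide)
    convert this using 1
    ext i; fin_cases i <;> rfl
  · refine aux_van ω _ e (hC e) ?_
    intro p q
    simp only [he, hb]
    exact sub_eq_zero.mp (hAB p q).1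
  · refine aux_van ω' _ e (hD e) ?_
    intro p q
    simp only [he, hb]
    exact sub_eq_zero.mp (hAB p q).2
end
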